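/- arXiv:2404.01152 — 5 statements merged into one kernel-verified Lean document; each statement's English description precedes it below -/
import Mathlib

section
/- Let n ≥ 2 and let Ω ⊂ ℝ^n be a bounded open set. Then the ℂ-linear span of the set of products { x ↦ e^{ρ₁·x} e^{ρ₂·x} : ρ₁, ρ₂ ∈ ℂ^n with ρ₁·ρ₁ = 0 and ρ₂·ρ₂ = 0 } is dense in C(closure(Ω), ℂ) with respect to the supremum norm. -/
open Complex

/-- Every real vector in dimension at least two is orthogonal to a real vector of the same length. -/
lemma exists_orthogonal_of_equal_norm {n : ℕ} (hn : 2 ≤ n) (ξ : EuclideanSpace ℝ (Fin n)) :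
    ∃ η : EuclideanSpace ℝ (Fin n), inner ℝ ξ η = 0 ∧ ‖η‖ = ‖ξ‖ := by
  have hrank : (ℝ ∙ ξ)ᗮ ≠ ⊥ := by
    intro h
    have hsum := Submodule.finrank_add_finrank_orthogonal (ℝ ∙ ξ)
    rw [h, finrank_bot, finrank_euclideanSpace_fin] at hsum
    have hle : Module.finrank ℝ (ℝ ∙ ξ) ≤ 1 := by
      simpa using finrank_span_le_card (R := ℝ) {ξ}
    omega
  obtain ⟨v, hv, hv0⟩ := Submodule.exists_mem_ne_zero_of_ne_bot hrank
  have hξv : inner ℝ ξ v = 0 := Submodule.mem_orthogonal_singleton_iff_inner_right.mp hv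
  refine ⟨(‖ξ‖ / ‖v‖) • v, by rw [inner_smul_right, hξv, mul_zero], ?_⟩
  rw [norm_smul, Real.norm_of_nonneg (by positivity), div_mul_cancel₀ _ (norm_ne_zero_iff.mpr hv0)]

/-- In dimension at least two, every real vector is the sum of two complex vectors whose bilinear
square vanishes. -/
lemma exists_isotropic_add_eq {n : ℕ} (hn : 2 ≤ n) (ξ : EuclideanSpace ℝ (Fin n)) :
    ∃ ρ₁ ρ₂ : Fin n → ℂ, (∑ j, ρ₁ j ^ 2 = 0) ∧ (∑ j, ρ₂ j ^ 2 = 0) ∧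
      ∀ j, ρ₁ j + ρ₂ j = (ξ j : ℂ) := by
  obtain ⟨η, horth, hnorm⟩ := exists_orthogonal_of_equal_norm hn ξ
  have horth' : ∑ j, (ξ j : ℂ) * (η j : ℂ) = 0 := by
    rw [PiLp.inner_apply] at horth
    simp only [RCLike.inner_apply, conj_trivial] at horth
    simp_rw [mul_comm (η _)] at horth
    exact_mod_cast horth
  have hsq : ∑ j, (η j : ℂ) ^ 2 = ∑ j, (ξ j : ℂ) ^ 2 := by
    have h := congrArg (· ^ 2) hnorm
    simp only [EuclideanSpace.real_norm_sq_eq] at h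
    exact_mod_cast h
  have key : ∀ c : ℂ, c ^ 2 = -1 → ∑ j, (((ξ j : ℂ) + c * η j) / 2) ^ 2 = 0 := by
    intro c hc
    have hterm : ∀ j, (((ξ j : ℂ) + c * η j) / 2) ^ 2 =
        (1 / 4) * (ξ j : ℂ) ^ 2 + (c / 2) * ((ξ j : ℂ) * η j) - (1 / 4) * (η j : ℂ) ^ 2 := by
      intro j
      linear_combination (1 / 4) * (η j : ℂ) ^ 2 * hc
    simp_rw [hterm]
    rw [Finset.sum_sub_distrib, Finset.sum_add_distrib, ← Finset.mul_sum, ← Finset.mul_sum,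
      ← Finset.mul_sum, horth', hsq]
    ring
  exact ⟨fun j => ((ξ j : ℂ) + I * η j) / 2, fun j => ((ξ j : ℂ) + -I * η j) / 2,
    key I I_sq, key (-I) (by rw [neg_sq, I_sq]), fun j => by ring⟩

/-- The multiplicative monoid of real exponentials `x ↦ e^{ξ·x}`, `ξ ∈ ℝ^n`, as complex-valued
continuous functions on a subset of `ℝ^n`. -/
def realExponentials {n : ℕ} (K : Set (EuclideanSpace ℝ (Fin n))) : Submonoid C(K, ℂ) where
  carrier := {f | ∃ ξ : EuclideanSpace ℝ (Fin n), ∀ x : K,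
    f x = Complex.exp (∑ j, (ξ j : ℂ) * ((x : EuclideanSpace ℝ (Fin n)) j : ℂ))}
  one_mem' := ⟨0, fun x => by simp⟩
  mul_mem' := by
    rintro f g ⟨ξ, hf⟩ ⟨η, hg⟩
    refine ⟨ξ + η, fun x => ?_⟩
    rw [ContinuousMap.mul_apply, hf, hg, ← Complex.exp_add, ← Finset.sum_add_distrib]
    simp [add_mul]

lemma star_eq_self_of_mem_realExponentials {n : ℕ} {K : Set (EuclideanSpace ℝ (Fin n))}
    {f : C(K, ℂ)} (hf : f ∈ realExponentials K) : star f = f := by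
  obtain ⟨ξ, hξ⟩ := hf
  ext x
  rw [ContinuousMap.star_apply, hξ, Complex.star_def, ← Complex.exp_conj]
  simp

lemma exists_mem_realExponentials_apply_ne {n : ℕ} {K : Set (EuclideanSpace ℝ (Fin n))}
    {x y : K} (hxy : x ≠ y) : ∃ f ∈ realExponentials K, f x ≠ f y := by
  obtain ⟨i, hi⟩ : ∃ i, (x : EuclideanSpace ℝ (Fin n)) i ≠ (y : EuclideanSpace ℝ (Fin n)) i := by
    by_contra! h
    exact hxy (Subtype.ext (PiLp.ext h))
  refine ⟨⟨fun z => Complex.exp ((z : EuclideanSpace ℝ (Fin n)) i : ℂ), by fun_prop⟩,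
    ⟨EuclideanSpace.single i 1, fun z => ?_⟩, fun h => hi ?_⟩
  · simp [apply_ite]
  · simp only [ContinuousMap.coe_mk] at h
    exact Real.exp_injective (by exact_mod_cast h)

/-- The real exponentials span a dense subspace of the continuous functions on a compact set. -/
lemma dense_span_realExponentials {n : ℕ} (K : Set (EuclideanSpace ℝ (Fin n))) [CompactSpace K] :
    Dense (Submodule.span ℂ (realExponentials K : Set C(K, ℂ)) : Set C(K, ℂ)) := by
  let S : Set C(K, ℂ) := realExponentials K
  have hstar : star S = S := by
    ext f
    refine ⟨fun hf => ?_, fun hf => ?_⟩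
    · have h := star_eq_self_of_mem_realExponentials (Set.mem_star.mp hf)
      rw [star_star] at h
      rw [h]
      exact hf
    · rw [Set.mem_star, star_eq_self_of_mem_realExponentials hf]
      exact hf
  have hdense := ContinuousMap.starSubalgebra_topologicalClosure_eq_top_of_separatesPoints
    (StarAlgebra.adjoin ℂ S) (by
      intro x y hxy
      obtain ⟨f, hf, hne⟩ := exists_mem_realExponentials_apply_ne hxy
      exact ⟨f, ⟨f, StarAlgebra.subset_adjoin ℂ S hf, rfl⟩, hne⟩)
  have hcoe : (StarAlgebra.adjoin ℂ S : Set C(K, ℂ)) = Submodule.span ℂ S := by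
    have h : (StarAlgebra.adjoin ℂ S).toSubalgebra = Algebra.adjoin ℂ S := by
      rw [StarAlgebra.adjoin_toSubalgebra, hstar, Set.union_self]
    rw [← StarSubalgebra.coe_toSubalgebra, h, ← Subalgebra.coe_toSubmodule,
      Algebra.adjoin_eq_span, Submonoid.closure_eq]
  change Dense (Submodule.span ℂ S : Set C(K, ℂ))
  rw [← hcoe, dense_iff_closure_eq, ← StarSubalgebra.topologicalClosure_coe, hdense]
  rfl

/-- **Completeness of products of Calderón exponential harmonic functions.**
Let `n ≥ 2` and let `Ω ⊂ ℝ^n` be a bounded open set. The ℂ-linear span of the products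
`x ↦ e^{ρ₁·x} e^{ρ₂·x}` over `ρ₁, ρ₂ ∈ ℂ^n` with `ρ₁·ρ₁ = ρ₂·ρ₂ = 0` is dense in
`C(closure Ω, ℂ)` (with the supremum norm, i.e. the compact-open topology on the compact
set `closure Ω`). -/
theorem density_of_products_of_exponential_harmonics
    (n : ℕ) (hn : 2 ≤ n) (Ω : Set (EuclideanSpace ℝ (Fin n)))
    (hΩo : IsOpen Ω) (hΩb : Bornology.IsBounded Ω) :
    Dense (↑(Submodule.span ℂ
      {f : C(closure Ω, ℂ) | ∃ ρ₁ ρ₂ : Fin n → ℂ,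
        (∑ j, ρ₁ j ^ 2 = 0) ∧ (∑ j, ρ₂ j ^ 2 = 0) ∧
        ∀ x : closure Ω,
          f x = Complex.exp (∑ j, ρ₁ j * ((x : EuclideanSpace ℝ (Fin n)) j : ℂ)) *
            Complex.exp (∑ j, ρ₂ j * ((x : EuclideanSpace ℝ (Fin n)) j : ℂ))}) :
      Set C(closure Ω, ℂ)) := by
  have : CompactSpace (closure Ω) := isCompact_iff_compactSpace.mp hΩb.isCompact_closure
  refine (dense_span_realExponentials (closure Ω)).mono (Submodule.span_mono ?_)
  rintro f ⟨ξ, hf⟩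
  obtain ⟨ρ₁, ρ₂, h₁, h₂, hadd⟩ := exists_isotropic_add_eq hn ξ
  refine ⟨ρ₁, ρ₂, h₁, h₂, fun x => ?_⟩
  rw [hf, ← Complex.exp_add, ← Finset.sum_add_distrib]
  simp_rw [← add_mul, hadd]
end

section
/- Let n ≥ 3 and let Ω ⊂ ℝ^n be a bounded open set. Then the ℂ-linear span of the set of products { x ↦ |x−x₁|^{2−n} |x−x₂|^{2−n} : x₁, x₂ ∈ ℝ^n \ closure(Ω) } is dense in C(closure(Ω), ℂ) with respect to the supremum norm. -/
open Filter Topology Metric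
open scoped Pointwise

section ClosedSubmodule

variable {F : Type*} [NormedAddCommGroup F] [NormedSpace ℂ F]

/-- A holomorphic map on a disc centred at the origin whose values at the nonzero real points lie
in a closed subspace takes all its values in that subspace. -/
theorem mem_of_differentiableOn_of_forall_real_mem [CompleteSpace F] {V : Submodule ℂ F}
    (hV : IsClosed (V : Set F)) {f : ℂ → F} {δ : ℝ} (hf : DifferentiableOn ℂ f (ball 0 δ))
    (hreal : ∀ t : ℝ, t ≠ 0 → |t| < δ → f t ∈ V) {z : ℂ} (hz : z ∈ ball 0 δ) : f z ∈ V := by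
  have : IsClosed (V : Set F) := hV
  have hδ : 0 < δ := (norm_nonneg z).trans_lt (by simpa using hz)
  have hq : AnalyticOnNhd ℂ (fun w ↦ V.mkQL (f w)) (ball 0 δ) :=
    (V.mkQL.differentiable.comp_differentiableOn hf).analyticOnNhd isOpen_ball
  have key := hq.eqOn_zero_of_preconnected_of_frequently_eq_zero (z₀ := 0)
    (convex_ball (0 : ℂ) δ).isPreconnected (mem_ball_self hδ) ?_ hz
  · simpa using key
  · have hlim : Tendsto (fun t : ℝ ↦ (t : ℂ)) (𝓝[≠] 0) (𝓝[≠] 0) := by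
      refine tendsto_nhdsWithin_iff.2 ⟨?_, ?_⟩
      · exact (Complex.continuous_ofReal.tendsto' 0 0 (by simp)).mono_left nhdsWithin_le_nhds
      · filter_upwards [self_mem_nhdsWithin] with t ht using by simpa using ht
    refine hlim.frequently (Eventually.frequently ?_)
    filter_upwards [self_mem_nhdsWithin, nhdsWithin_le_nhds (ball_mem_nhds (0 : ℝ) hδ)]
      with t ht htδ
    simpa using hreal t ht (by simpa using htδ)

/-- If a power series takes its values near the origin in a closed subspace, then its coefficients
lie in that subspace. -/
theorem HasFPowerSeriesAt.coeff_mem {V : Submodule ℂ F} (hV : IsClosed (V : Set F)) {f : ℂ → F}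
    {p : FormalMultilinearSeries ℂ ℂ F} (hp : HasFPowerSeriesAt f p 0)
    (hf : ∀ᶠ z in 𝓝 0, f z ∈ V) (k : ℕ) : p.coeff k ∈ V := by
  have : IsClosed (V : Set F) := hV
  obtain ⟨r, hr⟩ := hp
  have h0 : HasFPowerSeriesAt 0 (V.mkQL.compFormalMultilinearSeries p) (0 : ℂ) := by
    refine (V.mkQL.comp_hasFPowerSeriesOnBall hr).hasFPowerSeriesAt.congr ?_
    filter_upwards [hf] with z hz
    simpa using hz
  have := congrArg (fun q ↦ q k 1) h0.eq_zero
  exact (Submodule.Quotient.mk_eq_zero V).1 this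

end ClosedSubmodule

section Binomial

/-- The binomial series converges on the unit ball of any normed algebra. -/
theorem one_le_radius_binomialSeries (A : Type*) [NormedRing A] [NormedAlgebra ℂ A]
    [NormOneClass A] (a : ℂ) : 1 ≤ (binomialSeries A a).radius := by
  have h : (binomialSeries A a).radius = (binomialSeries ℂ a).radius := by
    simp only [FormalMultilinearSeries.radius, binomialSeries,
      FormalMultilinearSeries.ofScalars_norm]
  exact h ▸ binomialSeries_radius_ge_one

theorem hasFPowerSeriesOnBall_binomialSeries_sum (A : Type*) [NormedRing A] [NormedAlgebra ℂ A]
    [NormOneClass A] [CompleteSpace A] (a : ℂ) :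
    HasFPowerSeriesOnBall (binomialSeries A a).sum (binomialSeries A a) 0 1 :=
  ((binomialSeries A a).hasFPowerSeriesOnBall
    (zero_lt_one.trans_le (one_le_radius_binomialSeries A a))).mono zero_lt_one
    (one_le_radius_binomialSeries A a)

theorem binomialSeries_sum_apply {X : Type*} [TopologicalSpace X] [CompactSpace X] [Nonempty X]
    (a : ℂ) {g : C(X, ℂ)} (hg : ‖g‖ < 1) (x : X) :
    (binomialSeries C(X, ℂ) a).sum g x = (1 + g x) ^ a := by
  have h1 := ((hasFPowerSeriesOnBall_binomialSeries_sum C(X, ℂ) a).hasSum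
    (y := g) (mem_eball_zero_iff.2 (by simpa [enorm] using! hg))).map (ContinuousMap.evalCLM ℂ x)
    (ContinuousMap.evalCLM ℂ x).continuous
  have h2 := (Complex.one_add_cpow_hasFPowerSeriesOnBall_zero (a := a)).hasSum
    (y := g x) (mem_eball_zero_iff.2 (by simpa [enorm] using! (g.norm_coe_le_norm x).trans_lt hg))
  have h3 : ((ContinuousMap.evalCLM ℂ x) ∘ fun k ↦ binomialSeries C(X, ℂ) a k fun _ ↦ g) =
      fun k ↦ binomialSeries ℂ a k fun _ ↦ g x := by
    ext k
    simp [-FormalMultilinearSeries.apply_eq_prod_smul_coeff]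
  rw [h3] at h1
  simpa using h1.unique h2

theorem Ring.choose_ne_zero_of_neg {s : ℝ} (hs : s < 0) (k : ℕ) : Ring.choose (s : ℂ) k ≠ 0 := by
  rw [← Complex.ofReal_choose, Complex.ofReal_ne_zero]
  intro h
  have := Ring.descPochhammer_eq_factorial_smul_choose s k
  rw [h, smul_zero, ← Polynomial.aeval_eq_smeval, ← Polynomial.eval_map_algebraMap, descPochhammer_map,
    descPochhammer_eval_eq_prod_range, Finset.prod_eq_zero_iff] at this
  obtain ⟨j, -, hj⟩ := this
  have : (0 : ℝ) ≤ j := j.cast_nonneg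
  linarith

end Binomial

section RieszKernel

variable {E : Type*} [NormedAddCommGroup E]

/-- The continuous function `x ↦ ‖x‖ ^ 2` on `K`, as a complex-valued function. -/
noncomputable def normSqOn (K : Set E) : C(K, ℂ) :=
  ⟨fun x ↦ ((‖(x : E)‖ ^ 2 : ℝ) : ℂ), by fun_prop⟩

@[simp]
theorem normSqOn_apply (K : Set E) (x : K) : normSqOn K x = ((‖(x : E)‖ ^ 2 : ℝ) : ℂ) := rfl

/-- The restrictions to `K` of the kernels `x ↦ ‖x - x₀‖ ^ s` with pole `x₀ ∉ K`. -/
def rieszKernels (K : Set E) (s : ℝ) : Set C(K, ℂ) :=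
  {f | ∃ x₀ ∉ K, ∀ x : K, f x = ((‖(x : E) - x₀‖ ^ s : ℝ) : ℂ)}

/-- The closed linear span of the kernels `x ↦ ‖x - x₀‖ ^ s` with pole `x₀ ∉ K`. -/
noncomputable def rieszSpan (K : Set E) [CompactSpace K] (s : ℝ) : Submodule ℂ C(K, ℂ) :=
  (Submodule.span ℂ (rieszKernels K s)).topologicalClosure

theorem isClosed_rieszSpan (K : Set E) [CompactSpace K] (s : ℝ) :
    IsClosed (rieszSpan K s : Set C(K, ℂ)) :=
  Submodule.isClosed_topologicalClosure _

/-- Products of two elements of `rieszSpan K s` are limits of linear combinations of products of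
two kernels. -/
theorem mul_mem_topologicalClosure_span_rieszKernels_mul {K : Set E} [CompactSpace K] {s : ℝ}
    {f g : C(K, ℂ)} (hf : f ∈ rieszSpan K s) (hg : g ∈ rieszSpan K s) :
    f * g ∈ (Submodule.span ℂ (rieszKernels K s * rieszKernels K s)).topologicalClosure := by
  refine map_mem_closure₂ continuous_mul hf hg fun a ha b hb ↦ ?_
  rw [SetLike.mem_coe, ← Submodule.span_mul_span]
  exact Submodule.mul_mem_mul ha hb

variable [InnerProductSpace ℝ E]

/-- The continuous function `x ↦ ⟪w, x⟫` on `K`, as a complex-valued function. -/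
noncomputable def innerOn (K : Set E) (w : E) : C(K, ℂ) :=
  ⟨fun x ↦ ((inner ℝ w (x : E) : ℝ) : ℂ), by fun_prop⟩

@[simp]
theorem innerOn_apply (K : Set E) (w : E) (x : K) :
    innerOn K w x = ((inner ℝ w (x : E) : ℝ) : ℂ) := rfl

theorem norm_sq_mul_norm_sub_inversion_sq {w : E} (hw : w ≠ 0) (x : E) :
    (‖w‖ * ‖x - (‖w‖ ^ 2)⁻¹ • w‖) ^ 2 = 1 - 2 * inner ℝ w x + ‖w‖ ^ 2 * ‖x‖ ^ 2 := by
  have hw' : ‖w‖ ≠ 0 := norm_ne_zero_iff.2 hw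
  rw [mul_pow, norm_sub_sq_real, inner_smul_right, norm_smul, real_inner_comm, norm_inv, norm_pow,
    norm_norm]
  field_simp
  ring

variable {K : Set E} [CompactSpace K] [Nonempty K] {s : ℝ}

/-- Moving the pole to the inverse point of `w` and renormalising gives
`(1 - 2⟪w, x⟫ + ‖w‖² ‖x‖²) ^ (s / 2)`. -/
theorem binomialSeries_sum_mem_rieszSpan {w : E} (hw : w ≠ 0)
    (hg : ‖(-2 : ℂ) • innerOn K w + ((‖w‖ ^ 2 : ℝ) : ℂ) • normSqOn K‖ < 1) :
    (binomialSeries C(K, ℂ) ((s / 2 : ℝ) : ℂ)).sum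
      ((-2 : ℂ) • innerOn K w + ((‖w‖ ^ 2 : ℝ) : ℂ) • normSqOn K) ∈ rieszSpan K s := by
  set g := (-2 : ℂ) • innerOn K w + ((‖w‖ ^ 2 : ℝ) : ℂ) • normSqOn K with hgdef
  set x₀ : E := (‖w‖ ^ 2)⁻¹ • w
  have hval (x : K) : 1 + g x = (((‖w‖ * ‖(x : E) - x₀‖) ^ 2 : ℝ) : ℂ) := by
    rw [norm_sq_mul_norm_sub_inversion_sq hw]
    simp [hgdef]
    ring
  have hx₀ : x₀ ∉ K := by
    intro hmem
    have h0 := hval ⟨x₀, hmem⟩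
    have h1 := (g.norm_coe_le_norm ⟨x₀, hmem⟩).trans_lt hg
    have h2 : g ⟨x₀, hmem⟩ = -1 := by
      simp only [sub_self, norm_zero, mul_zero, ne_eq, OfNat.ofNat_ne_zero, not_false_eq_true,
        zero_pow, Complex.ofReal_zero] at h0
      linear_combination h0
    simp [h2] at h1
  have hne (x : K) : (x : E) - x₀ ≠ 0 := fun h ↦ hx₀ (sub_eq_zero.1 h ▸ x.2)
  let f : C(K, ℂ) := ⟨fun x ↦ ((‖(x : E) - x₀‖ ^ s : ℝ) : ℂ), by
    refine Complex.continuous_ofReal.comp (Continuous.rpow_const (by fun_prop) fun x ↦ .inl ?_)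
    exact norm_ne_zero_iff.2 (hne x)⟩
  have hf : f ∈ rieszSpan K s :=
    Submodule.le_topologicalClosure _ (Submodule.subset_span ⟨x₀, hx₀, fun _ ↦ rfl⟩)
  have heq : (binomialSeries C(K, ℂ) ((s / 2 : ℝ) : ℂ)).sum g = ((‖w‖ ^ s : ℝ) : ℂ) • f := by
    ext x
    rw [binomialSeries_sum_apply _ hg, hval, ← Complex.ofReal_cpow (by positivity),
      ContinuousMap.smul_apply, smul_eq_mul, ContinuousMap.coe_mk, ← Complex.ofReal_mul,
      ← Real.mul_rpow (norm_nonneg _) (norm_nonneg _), ← Real.rpow_natCast,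
      ← Real.rpow_mul (by positivity)]
    congr 3
    push_cast
    ring
  exact heq ▸ Submodule.smul_mem _ _ hf

/-- Powers of the isotropic complex linear forms `x ↦ ⟪u, x⟫ + i⟪v, x⟫`, where `u ⟂ v` and
`‖u‖ = ‖v‖`, are limits of linear combinations of kernels. -/
theorem isotropic_pow_mem_rieszSpan (hs : s < 0) {u v : E} (hu : u ≠ 0) (huv : ‖v‖ = ‖u‖)
    (horth : inner ℝ u v = 0) (k : ℕ) :
    (innerOn K u + Complex.I • innerOn K v) ^ k ∈ rieszSpan K s := by
  have hA := isClosed_rieszSpan K s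
  have hB := hasFPowerSeriesOnBall_binomialSeries_sum C(K, ℂ) ((s / 2 : ℝ) : ℂ)
  set B := (binomialSeries C(K, ℂ) ((s / 2 : ℝ) : ℂ)).sum
  have hBd : DifferentiableOn ℂ B (ball 0 1) := by
    simpa [← ENNReal.ofReal_one, Metric.eball_ofReal] using hB.differentiableOn
  let G : ℂ → ℂ → C(K, ℂ) := fun a b ↦
    (-2 : ℂ) • (a • innerOn K u + b • innerOn K v) +
      ((a ^ 2 + b ^ 2) * ((‖u‖ ^ 2 : ℝ) : ℂ)) • normSqOn K
  have hG : Continuous fun p : ℂ × ℂ ↦ G p.1 p.2 := by fun_prop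
  obtain ⟨δ, hδ, hGδ⟩ : ∃ δ > 0, ∀ a b : ℂ, ‖a‖ < δ → ‖b‖ < δ → ‖G a b‖ < 1 := by
    have hev : ∀ᶠ p : ℂ × ℂ in 𝓝 0, ‖G p.1 p.2‖ < 1 :=
      (hG.norm.tendsto 0).eventually (gt_mem_nhds (by simp [G]))
    obtain ⟨δ, hδ, h⟩ := Metric.eventually_nhds_iff.1 hev
    exact ⟨δ, hδ, fun a b ha hb ↦ h (y := (a, b)) (by simp [Prod.norm_def, ha, hb])⟩
  have hreal (a b : ℝ) (ha : a ≠ 0) (haδ : |a| < δ) (hbδ : |b| < δ) :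
      B (G a b) ∈ rieszSpan K s := by
    have hnorm : ‖a • u + b • v‖ ^ 2 = (a ^ 2 + b ^ 2) * ‖u‖ ^ 2 := by
      rw [norm_add_sq_real, inner_smul_left, inner_smul_right, horth, norm_smul, norm_smul, huv,
        mul_pow, mul_pow, Real.norm_eq_abs, Real.norm_eq_abs, sq_abs, sq_abs]
      simp
      ring
    have hw : a • u + b • v ≠ 0 := by
      rw [← norm_ne_zero_iff, ← pow_ne_zero_iff two_ne_zero, hnorm]
      have := norm_pos_iff.2 hu
      positivity
    have hGw : G a b = (-2 : ℂ) • innerOn K (a • u + b • v) +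
        ((‖a • u + b • v‖ ^ 2 : ℝ) : ℂ) • normSqOn K := by
      rw [hnorm]
      ext x
      simp [G, inner_add_left, inner_smul_left]
      ring
    rw [hGw]
    refine binomialSeries_sum_mem_rieszSpan hw (hGw ▸ hGδ a b ?_ ?_) <;> simpa
  have hstep (a : ℝ) (ha : a ≠ 0) (haδ : |a| < δ) (b : ℂ) (hb : b ∈ ball 0 δ) :
      B (G a b) ∈ rieszSpan K s := by
    refine mem_of_differentiableOn_of_forall_real_mem hA (f := fun b ↦ B (G a b))
      (hBd.comp (by fun_prop) fun z hz ↦ ?_) (fun t _ ht ↦ hreal a t ha haδ ht) hb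
    simpa using hGδ a z (by simpa) (by simpa using hz)
  have hcomplex (a b : ℂ) (ha : a ∈ ball 0 δ) (hb : b ∈ ball 0 δ) :
      B (G a b) ∈ rieszSpan K s := by
    refine mem_of_differentiableOn_of_forall_real_mem hA (f := fun a ↦ B (G a b))
      (hBd.comp (by fun_prop) fun z hz ↦ ?_) (fun t ht ht' ↦ hstep t ht ht' b hb) ha
    simpa using hGδ z b (by simpa using hz) (by simpa using hb)
  set c : C(K, ℂ) := innerOn K u + Complex.I • innerOn K v
  let L : ℂ →L[ℂ] C(K, ℂ) := ContinuousLinearMap.toSpanSingleton ℂ ((-2 : ℂ) • c)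
  have hps : HasFPowerSeriesAt (B ∘ L)
      ((binomialSeries C(K, ℂ) ((s / 2 : ℝ) : ℂ)).compContinuousLinearMap L) 0 := by
    obtain ⟨r, hr⟩ := (show HasFPowerSeriesAt B _ (L 0) from (map_zero L).symm ▸ hB.hasFPowerSeriesAt)
    exact hr.compContinuousLinearMap.hasFPowerSeriesAt
  have hmem := hps.coeff_mem hA (by
    filter_upwards [ball_mem_nhds (0 : ℂ) hδ] with z hz
    have hLG : L z = G z (Complex.I * z) := by
      ext x
      simp [L, G, c, mul_pow]
      ring
    rw [Function.comp_apply, hLG]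
    exact hcomplex _ _ hz (by simpa using hz)) k
  have hcoeff : ((binomialSeries C(K, ℂ) ((s / 2 : ℝ) : ℂ)).compContinuousLinearMap L).coeff k =
      (Ring.choose ((s / 2 : ℝ) : ℂ) k * (-2) ^ k) • c ^ k := by
    rw [FormalMultilinearSeries.coeff, FormalMultilinearSeries.compContinuousLinearMap_apply,
      binomialSeries_apply]
    rw [mul_smul, ← smul_pow]
    simp [L, List.prod_ofFn]
  rw [hcoeff] at hmem
  exact (Submodule.smul_mem_iff _ (mul_ne_zero (Ring.choose_ne_zero_of_neg (by linarith) k)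
    (by simp))).1 hmem

end RieszKernel

section Density

variable {E : Type*} [NormedAddCommGroup E] [InnerProductSpace ℝ E]

theorem exists_norm_eq_inner_eq_zero (hE : 2 ≤ Module.finrank ℝ E) (u : E) :
    ∃ v : E, ‖v‖ = ‖u‖ ∧ inner ℝ u v = 0 := by
  have : FiniteDimensional ℝ E := Module.finite_of_finrank_pos (by omega)
  have hne : (ℝ ∙ u)ᗮ ≠ ⊥ := by
    intro h
    have h1 := (ℝ ∙ u).finrank_add_finrank_orthogonal
    have h2 := finrank_span_le_card (R := ℝ) {u}
    rw [h, finrank_bot] at h1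
    rw [Set.toFinset_singleton, Finset.card_singleton] at h2
    omega
  obtain ⟨v, hv, hv0⟩ := Submodule.exists_mem_ne_zero_of_ne_bot hne
  refine ⟨(‖u‖ / ‖v‖) • v, ?_, ?_⟩
  · rw [norm_smul, norm_div, norm_norm, norm_norm, div_mul_cancel₀ _ (norm_ne_zero_iff.2 hv0)]
  · rw [inner_smul_right, Submodule.mem_orthogonal_singleton_iff_inner_right.1 hv, mul_zero]

/-- The continuous function `x ↦ exp ⟪w, x⟫` on `K`, as a complex-valued function. -/
noncomputable def expInnerOn (K : Set E) (w : E) : C(K, ℂ) :=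
  ⟨fun x ↦ Complex.exp (inner ℝ w (x : E) : ℝ), by fun_prop⟩

@[simp]
theorem expInnerOn_apply (K : Set E) (w : E) (x : K) :
    expInnerOn K w x = Complex.exp (inner ℝ w (x : E) : ℝ) := rfl

theorem hasSum_expInnerOn (K : Set E) [CompactSpace K] (w : E) :
    HasSum (fun k : ℕ ↦ ((k.factorial : ℂ)⁻¹) • innerOn K w ^ k) (expInnerOn K w) := by
  have h := NormedSpace.exp_series_hasSum_exp' (𝕂 := ℂ) (innerOn K w)
  suffices NormedSpace.exp (innerOn K w) = expInnerOn K w from this ▸ h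
  ext x
  have h1 := h.map (ContinuousMap.evalCLM ℂ x) (ContinuousMap.evalCLM ℂ x).continuous
  have h2 := NormedSpace.exp_series_hasSum_exp' (𝕂 := ℂ) (innerOn K w x)
  rw [← Complex.exp_eq_exp_ℂ] at h2
  exact h1.unique h2

/-- Linear combinations of the exponentials `x ↦ exp ⟪w, x⟫` are dense in `C(K, ℂ)`. -/
theorem topologicalClosure_span_range_expInnerOn (K : Set E) [CompactSpace K] :
    (Submodule.span ℂ (Set.range (expInnerOn K))).topologicalClosure = ⊤ := by
  let M : Submonoid C(K, ℂ) :=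
    { carrier := Set.range (expInnerOn K)
      one_mem' := ⟨0, by ext; simp⟩
      mul_mem' := by
        rintro _ _ ⟨w, rfl⟩ ⟨w', rfl⟩
        exact ⟨w + w', by ext; simp [inner_add_left, Complex.exp_add]⟩ }
  have hstar : star (M : Set C(K, ℂ)) = M := by
    have hfix (w : E) : star (expInnerOn K w) = expInnerOn K w := by
      ext x
      simp [← Complex.exp_conj]
    ext f
    constructor
    · rintro ⟨w, hw⟩
      exact ⟨w, by rw [← hfix, hw, star_star]⟩
    · rintro ⟨w, rfl⟩
      exact ⟨w, (hfix w).symm⟩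
  let A : StarSubalgebra ℂ C(K, ℂ) :=
    { Algebra.adjoin ℂ (M : Set C(K, ℂ)) with
      star_mem' := fun {f} hf ↦ by
        change star f ∈ Algebra.adjoin ℂ (M : Set C(K, ℂ))
        rwa [← Subalgebra.mem_star_iff, Subalgebra.star_adjoin_comm, hstar] }
  have hsep : A.SeparatesPoints := by
    intro x y hxy
    refine ⟨expInnerOn K ((x : E) - y), ⟨_, Algebra.subset_adjoin ⟨_, rfl⟩, rfl⟩, fun h ↦ hxy ?_⟩
    rw [expInnerOn_apply, expInnerOn_apply, ← Complex.ofReal_exp, ← Complex.ofReal_exp,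
      Complex.ofReal_inj, Real.exp_eq_exp, ← sub_eq_zero, ← inner_sub_right,
      inner_self_eq_zero, sub_eq_zero] at h
    exact Subtype.ext h
  have htop := ContinuousMap.starSubalgebra_topologicalClosure_eq_top_of_separatesPoints A hsep
  have hspan : ((Submodule.span ℂ (Set.range (expInnerOn K)) : Submodule ℂ C(K, ℂ)) :
      Set C(K, ℂ)) = A := by
    have := Algebra.adjoin_eq_span ℂ (M : Set C(K, ℂ))
    rw [Submonoid.closure_eq] at this
    exact (congrArg (fun N : Submodule ℂ C(K, ℂ) ↦ (N : Set C(K, ℂ))) this).symm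
  rw [← Submodule.dense_iff_topologicalClosure_eq_top, hspan, dense_iff_closure_eq,
    ← StarSubalgebra.topologicalClosure_coe, htop, StarSubalgebra.coe_top]

/-- In dimension at least two, for `s < 0` the products of two kernels `x ↦ ‖x - x₀‖ ^ s` with
poles off the compact set `K` span a dense subspace of `C(K, ℂ)`. -/
theorem dense_span_rieszKernels_mul (hE : 2 ≤ Module.finrank ℝ E) (K : Set E) [CompactSpace K]
    {s : ℝ} (hs : s < 0) :
    Dense (Submodule.span ℂ (rieszKernels K s * rieszKernels K s) : Set C(K, ℂ)) := by
  cases isEmpty_or_nonempty K with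
  | inl _ =>
    intro f
    rw [Subsingleton.elim f 0]
    exact subset_closure (Submodule.zero_mem _)
  | inr _ =>
  set D := (Submodule.span ℂ (rieszKernels K s * rieszKernels K s)).topologicalClosure with hD
  have hpow {w : E} (hw : w ≠ 0) (m : ℕ) : innerOn K w ^ m ∈ D := by
    obtain ⟨v, hv, horth⟩ := exists_norm_eq_inner_eq_zero hE ((2⁻¹ : ℝ) • w)
    have hu : (2⁻¹ : ℝ) • w ≠ 0 := smul_ne_zero (by norm_num) hw
    have hsum : innerOn K w = (innerOn K ((2⁻¹ : ℝ) • w) + Complex.I • innerOn K v) +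
        (innerOn K ((2⁻¹ : ℝ) • w) + Complex.I • innerOn K (-v)) := by
      ext x
      simp [inner_smul_left]
      ring
    rw [hsum, add_pow]
    refine Submodule.sum_mem _ fun j _ ↦ ?_
    rw [← nsmul_eq_mul']
    exact Submodule.smul_of_tower_mem _ _ (mul_mem_topologicalClosure_span_rieszKernels_mul
      (isotropic_pow_mem_rieszSpan hs hu hv horth _)
      (isotropic_pow_mem_rieszSpan hs hu (by rwa [norm_neg])
        (by rw [inner_neg_right, horth, neg_zero]) _))
  have hexp (w : E) : expInnerOn K w ∈ D := by
    obtain rfl | hw := eq_or_ne w 0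
    · have : Nontrivial E := Module.nontrivial_of_finrank_pos (R := ℝ) (by omega)
      obtain ⟨w, hw⟩ := exists_ne (0 : E)
      convert hpow hw 0 using 1
      ext
      simp
    · exact (Submodule.isClosed_topologicalClosure _).mem_of_tendsto (hasSum_expInnerOn K w)
        (.of_forall fun t ↦ Submodule.sum_mem _ fun m _ ↦ Submodule.smul_mem _ _ (hpow hw m))
  rw [Submodule.dense_iff_topologicalClosure_eq_top, eq_top_iff,
    ← topologicalClosure_span_range_expInnerOn K]
  refine Submodule.topologicalClosure_minimal _ (Submodule.span_le.2 ?_)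
    (Submodule.isClosed_topologicalClosure _)
  rintro _ ⟨w, rfl⟩
  exact hexp w

end Density

/-- **Completeness of products of Green functions.** Let `n ≥ 3` and let `Ω ⊂ ℝ^n` be a
bounded open set. The ℂ-linear span of the products
`x ↦ |x - x₁|^{2-n} |x - x₂|^{2-n}` over poles `x₁, x₂ ∈ ℝ^n \ closure Ω` is dense in
`C(closure Ω, ℂ)` (with the supremum norm, i.e. the compact-open topology on the compact
set `closure Ω`). -/
theorem density_of_products_of_green_functions
    (n : ℕ) (hn : 3 ≤ n) (Ω : Set (EuclideanSpace ℝ (Fin n)))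
    (hΩo : IsOpen Ω) (hΩb : Bornology.IsBounded Ω) :
    Dense (↑(Submodule.span ℂ
      {f : C(closure Ω, ℂ) | ∃ x₁ x₂ : EuclideanSpace ℝ (Fin n),
        x₁ ∉ closure Ω ∧ x₂ ∉ closure Ω ∧
        ∀ x : closure Ω,
          f x = ((‖(x : EuclideanSpace ℝ (Fin n)) - x₁‖ ^ ((2 : ℝ) - n) *
            ‖(x : EuclideanSpace ℝ (Fin n)) - x₂‖ ^ ((2 : ℝ) - n) : ℝ) : ℂ)}) :
      Set C(closure Ω, ℂ)) := by
  have : CompactSpace (closure Ω) := isCompact_iff_compactSpace.1 hΩb.isCompact_closure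
  have hn' : (3 : ℝ) ≤ n := by exact_mod_cast hn
  refine (dense_span_rieszKernels_mul (by simpa using by omega) (closure Ω)
    (s := 2 - n) (by linarith)).mono (Submodule.span_mono ?_)
  rintro _ ⟨f, ⟨x₁, hx₁, hf⟩, g, ⟨x₂, hx₂, hg⟩, rfl⟩
  refine ⟨x₁, x₂, hx₁, hx₂, fun x ↦ ?_⟩
  rw [Complex.ofReal_mul, ← hf, ← hg]
  rfl
end

section
/- Let n ≥ 3, let Ω ⊂ ℝ^n be a bounded open set, and let μ be a bounded measure on closure(Ω). If ∫_{closure(Ω)} |x−y|^{4−2n} dμ(y) = 0 for every x ∈ ℝ^n \ closure(Ω), then μ = 0. -/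
open Filter Topology

/-- Derivative of powers of the inverse along a differentiable curve in a commutative Banach algebra. -/
theorem HasDerivAt.ringInverse_pow {A : Type*} [NormedCommRing A] [NormedAlgebra ℝ A]
    [CompleteSpace A] {G : ℝ → A} {G' : A} {t : ℝ} (hG : HasDerivAt G G' t)
    (hu : IsUnit (G t)) (m : ℕ) :
    HasDerivAt (fun s => Ring.inverse (G s) ^ m)
      (-(m : A) * Ring.inverse (G t) ^ (m + 1) * G') t := by
  obtain ⟨u, hu⟩ := hu
  have h1 : HasDerivAt (fun s => Ring.inverse (G s)) (-(Ring.inverse (G t) ^ 2 * G')) t := by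
    have h := hasFDerivAt_ringInverse (𝕜 := ℝ) u
    rw [hu] at h
    refine (h.comp_hasDerivAt t hG).congr_deriv ?_
    rw [← hu, Ring.inverse_unit]
    simp only [neg_apply, ContinuousLinearMap.mulLeftRight_apply]
    ring
  refine (h1.fun_pow m).congr_deriv ?_
  rcases m with _ | m
  · simp
  · simp only [Nat.add_sub_cancel]
    ring

/-- If a functional kills `(U + 2 t D + t ^ 2)⁻ᵐ` for all small `t`, it kills the second derivative
of this curve at `t = 0`. -/
theorem map_second_deriv_ringInverse_pow_eq_zero {A F : Type*} [NormedCommRing A]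
    [NormedAlgebra ℝ A] [CompleteSpace A] [NormedAddCommGroup F] [NormedSpace ℝ F]
    (μ : A →L[ℝ] F) {U D : A} (hU : IsUnit U) (m : ℕ)
    (h : ∀ᶠ t in 𝓝 (0 : ℝ), μ (Ring.inverse (U + (2 * t) • D + t ^ 2 • (1 : A)) ^ m) = 0) :
    μ (4 * m * (m + 1) * Ring.inverse U ^ (m + 2) * D ^ 2 -
      2 * m * Ring.inverse U ^ (m + 1)) = 0 := by
  set G : ℝ → A := fun t => U + (2 * t) • D + t ^ 2 • (1 : A) with hGdef
  set G' : ℝ → A := fun t => (2 : ℝ) • D + (2 * t) • (1 : A) with hG'def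
  have hG : ∀ t, HasDerivAt G (G' t) t := fun t => by
    have h1 : HasDerivAt (fun t : ℝ => 2 * t) 2 t := by
      simpa using (hasDerivAt_id t).const_mul (2 : ℝ)
    have h2 : HasDerivAt (fun t : ℝ => t ^ 2) (2 * t) t := by
      simpa using hasDerivAt_pow 2 t
    exact ((h1.smul_const D).const_add U).fun_add (h2.smul_const (1 : A))
  have hG' : HasDerivAt G' ((2 : ℝ) • (1 : A)) 0 := by
    have h1 : HasDerivAt (fun t : ℝ => 2 * t) 2 0 := by
      simpa using (hasDerivAt_id (0 : ℝ)).const_mul (2 : ℝ)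
    exact (h1.smul_const (1 : A)).const_add _
  have hG0 : G 0 = U := by simp [G]
  have hunit : ∀ᶠ t in 𝓝 (0 : ℝ), IsUnit (G t) :=
    (hG 0).continuousAt.eventually_mem (Units.isOpen.mem_nhds (by rwa [hG0]))
  have hfirst : ∀ᶠ t in 𝓝 (0 : ℝ),
      μ (-(m : A) * Ring.inverse (G t) ^ (m + 1) * G' t) = 0 := by
    filter_upwards [h.eventually_nhds, hunit] with t ht hut
    have h1 := μ.hasFDerivAt.comp_hasDerivAt t ((hG t).ringInverse_pow hut m)
    exact h1.unique ((hasDerivAt_const t (0 : F)).congr_of_eventuallyEq ht)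
  have hsecond := (((hG 0).ringInverse_pow (by rwa [hG0]) (m + 1)).const_mul (-(m : A))).mul hG'
  have h0 := (μ.hasFDerivAt.comp_hasDerivAt 0 hsecond).unique
    ((hasDerivAt_const (0 : ℝ) (0 : F)).congr_of_eventuallyEq hfirst)
  rw [← h0]
  congr 1
  simp only [hG0, hG'def, mul_zero, zero_smul, add_zero, two_smul]
  push_cast
  ring

section Kernels

variable {n : ℕ} {K : Set (EuclideanSpace ℝ (Fin n))}

/-- The squared distance to `x`, as a complex-valued continuous function on `K`. -/
noncomputable def sqDistMap (K : Set (EuclideanSpace ℝ (Fin n))) (x : EuclideanSpace ℝ (Fin n)) :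
    C(K, ℂ) :=
  ⟨fun y => ((‖x - y‖ ^ 2 : ℝ) : ℂ), by fun_prop⟩

/-- The `i`-th coordinate of `x - y`, as a complex-valued continuous function of `y ∈ K`. -/
noncomputable def coordDiffMap (K : Set (EuclideanSpace ℝ (Fin n)))
    (x : EuclideanSpace ℝ (Fin n)) (i : Fin n) : C(K, ℂ) :=
  ⟨fun y => (((x - y) i : ℝ) : ℂ), by fun_prop⟩

/-- The function `y ↦ exp (⟪w, y⟫ - s ‖y‖ ^ 2)` on `K`. -/
noncomputable def expQuadMap (K : Set (EuclideanSpace ℝ (Fin n)))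
    (w : EuclideanSpace ℝ (Fin n)) (s : ℝ) : C(K, ℂ) :=
  ⟨fun y => ((Real.exp (inner ℝ w (y : EuclideanSpace ℝ (Fin n)) -
    s * ‖(y : EuclideanSpace ℝ (Fin n))‖ ^ 2) : ℝ) : ℂ), by fun_prop⟩

theorem sum_coordDiffMap_sq (x : EuclideanSpace ℝ (Fin n)) :
    ∑ i, coordDiffMap K x i ^ 2 = sqDistMap K x := by
  ext y
  simp [sqDistMap, coordDiffMap, EuclideanSpace.real_norm_sq_eq, ContinuousMap.sum_apply]

theorem sqDistMap_add_smul_single (x : EuclideanSpace ℝ (Fin n)) (i : Fin n) (t : ℝ) :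
    sqDistMap K (x + t • EuclideanSpace.single i (1 : ℝ)) =
      sqDistMap K x + (2 * t) • coordDiffMap K x i + t ^ 2 • (1 : C(K, ℂ)) := by
  ext y
  have h : ‖x + t • EuclideanSpace.single i (1 : ℝ) - y‖ ^ 2 =
      ‖x - y‖ ^ 2 + (2 * t) * (x - y) i + t ^ 2 := by
    rw [add_sub_right_comm, norm_add_sq_real, inner_smul_right, norm_smul, mul_pow]
    simp [EuclideanSpace.inner_single_right]
    ring
  simp only [sqDistMap, coordDiffMap, ContinuousMap.coe_mk, h]
  simp

theorem sqDist_pos {x : EuclideanSpace ℝ (Fin n)} (hx : x ∉ K) (y : K) : 0 < ‖x - y‖ ^ 2 := by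
  have : x - y ≠ 0 := sub_ne_zero.2 fun h => hx (h ▸ y.2)
  positivity

theorem isUnit_sqDistMap {x : EuclideanSpace ℝ (Fin n)} (hx : x ∉ K) :
    IsUnit (sqDistMap K x) := by
  rw [ContinuousMap.isUnit_iff_forall_ne_zero]
  intro y
  exact Complex.ofReal_ne_zero.2 (sqDist_pos hx y).ne'

theorem ringInverse_sqDistMap_apply {x : EuclideanSpace ℝ (Fin n)} (hx : x ∉ K) (y : K) :
    Ring.inverse (sqDistMap K x) y = (((‖x - y‖ ^ 2)⁻¹ : ℝ) : ℂ) := by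
  have h := congrArg (fun f : C(K, ℂ) => f y) (Ring.inverse_mul_cancel _ (isUnit_sqDistMap hx))
  rw [Complex.ofReal_inv]
  exact eq_inv_of_mul_eq_one_left h

theorem continuous_expQuadMap :
    Continuous fun p : EuclideanSpace ℝ (Fin n) × ℝ => expQuadMap K p.1 p.2 := by
  refine ContinuousMap.continuous_of_continuous_uncurry _ ?_
  simp only [Function.uncurry_def, expQuadMap, ContinuousMap.coe_mk]
  fun_prop

variable [CompactSpace K]

/-- Applying the Laplacian in `x` to a vanishing potential with kernel `‖x - y‖ ^ (-2 * m)` gives a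
vanishing potential with kernel `‖x - y‖ ^ (-2 * (m + 1))`. -/
theorem map_ringInverse_sqDistMap_pow_succ (hK : IsClosed K) (μ : C(K, ℂ) →L[ℂ] ℂ) {m : ℕ}
    (hm : m ≠ 0) (hmn : n < 2 * (m + 1))
    (h : ∀ x ∉ K, μ (Ring.inverse (sqDistMap K x) ^ m) = 0)
    {x : EuclideanSpace ℝ (Fin n)} (hx : x ∉ K) :
    μ (Ring.inverse (sqDistMap K x) ^ (m + 1)) = 0 := by
  set U := sqDistMap K x with hU
  have hderiv : ∀ i, μ (4 * m * (m + 1) * Ring.inverse U ^ (m + 2) * coordDiffMap K x i ^ 2 -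
      2 * m * Ring.inverse U ^ (m + 1)) = 0 := fun i => by
    refine map_second_deriv_ringInverse_pow_eq_zero (μ.restrictScalars ℝ)
      (isUnit_sqDistMap hx) m ?_
    have hcont : ContinuousAt
        (fun t : ℝ => x + t • EuclideanSpace.single i (1 : ℝ)) 0 := by fun_prop
    filter_upwards [hcont.eventually_mem (hK.isOpen_compl.mem_nhds (by simpa using hx))] with t ht
    rw [← sqDistMap_add_smul_single]
    exact h _ ht
  have hsum : ∑ i, (4 * m * (m + 1) * Ring.inverse U ^ (m + 2) * coordDiffMap K x i ^ 2 -
      2 * m * Ring.inverse U ^ (m + 1)) =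
      ((2 * m * (2 * (m + 1) - n) : ℝ) : ℂ) • Ring.inverse U ^ (m + 1) := by
    rw [Finset.sum_sub_distrib, ← Finset.mul_sum, sum_coordDiffMap_sq, ← hU]
    have hc : Ring.inverse U * U = 1 := Ring.inverse_mul_cancel _ (isUnit_sqDistMap hx)
    have hs : ((2 * m * (2 * (m + 1) - n) : ℝ) : ℂ) • Ring.inverse U ^ (m + 1) =
        (2 * m * (2 * (m + 1) - n)) * Ring.inverse U ^ (m + 1) := by
      ext y
      have h2 : (2 : C(K, ℂ)) y = 2 := rfl
      simp [h2]
    rw [hs, Finset.sum_const, Finset.card_univ, Fintype.card_fin, nsmul_eq_mul]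
    linear_combination (4 * m * (m + 1) * Ring.inverse U ^ (m + 1)) * hc
  have hzero := congrArg μ hsum
  rw [map_sum, Finset.sum_eq_zero fun i _ => hderiv i, map_smul, smul_eq_mul] at hzero
  refine (mul_eq_zero.1 hzero.symm).resolve_left (Complex.ofReal_ne_zero.2 ?_)
  have h1 : (n : ℝ) < 2 * (m + 1) := mod_cast hmn
  have h2 : (0 : ℝ) < m := mod_cast Nat.pos_of_ne_zero hm
  have h3 : (0 : ℝ) < 2 * (m + 1) - n := by linarith
  positivity

theorem map_ringInverse_sqDistMap_pow_add (hK : IsClosed K) (μ : C(K, ℂ) →L[ℂ] ℂ) {m : ℕ}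
    (hm : m ≠ 0) (hmn : n < 2 * (m + 1))
    (h : ∀ x ∉ K, μ (Ring.inverse (sqDistMap K x) ^ m) = 0) (k : ℕ) :
    ∀ x ∉ K, μ (Ring.inverse (sqDistMap K x) ^ (m + k)) = 0 := by
  induction k with
  | zero => exact h
  | succ k ih =>
    exact fun x hx => map_ringInverse_sqDistMap_pow_succ hK μ (by omega) (by omega) ih hx

theorem map_mul_comp_eq_zero (μ : C(K, ℂ) →L[ℂ] ℂ) {m : ℕ} {x : EuclideanSpace ℝ (Fin n)}
    (hx : x ∉ K) (h : ∀ k, μ (Ring.inverse (sqDistMap K x) ^ (m + k)) = 0) {g : ℝ → ℝ}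
    (hg : ContinuousOn g (Set.Ioi 0)) (G : C(K, ℂ)) (hG : ∀ y : K, G y = g (‖x - y‖ ^ 2)⁻¹) :
    μ (Ring.inverse (sqDistMap K x) ^ m * G) = 0 := by
  set V := Ring.inverse (sqDistMap K x) with hV
  have hpoly : ∀ q : Polynomial ℝ, μ (V ^ m * Polynomial.aeval V q) = 0 := fun q => by
    rw [Polynomial.aeval_eq_sum_range, Finset.mul_sum, map_sum]
    refine Finset.sum_eq_zero fun k _ => ?_
    rw [mul_smul_comm, ← pow_add]
    refine ((μ.restrictScalars ℝ).map_smul _ _).trans ?_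
    rw [ContinuousLinearMap.coe_restrictScalars', h k, smul_zero]
  have heval : ∀ (q : Polynomial ℝ) (y : K),
      Polynomial.aeval V q y = ((q.eval (‖x - y‖ ^ 2)⁻¹ : ℝ) : ℂ) := fun q y => by
    have h1 := Polynomial.aeval_algHom_apply (ContinuousMap.evalAlgHom ℝ ℂ y) V q
    have h2 : ContinuousMap.evalAlgHom ℝ ℂ y V = algebraMap ℝ ℂ (‖x - y‖ ^ 2)⁻¹ :=
      ringInverse_sqDistMap_apply hx y
    rw [h2, Polynomial.aeval_algebraMap_apply_eq_algebraMap_eval] at h1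
    exact h1.symm
  have hM : 0 < ‖sqDistMap K x‖ + 1 := by positivity
  have hmem : ∀ y : K, (‖x - y‖ ^ 2)⁻¹ ∈ Set.Icc (‖sqDistMap K x‖ + 1)⁻¹ ‖V‖ := fun y => by
    have hpos := sqDist_pos hx y
    constructor
    · refine inv_anti₀ hpos ?_
      have := (sqDistMap K x).norm_coe_le_norm y
      simp only [sqDistMap, ContinuousMap.coe_mk, Complex.norm_real, Real.norm_eq_abs,
        abs_of_pos hpos] at this ⊢
      linarith
    · have := V.norm_coe_le_norm y
      rwa [hV, ringInverse_sqDistMap_apply hx, Complex.norm_real, Real.norm_eq_abs,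
        abs_of_pos (inv_pos.2 hpos)] at this
  have hclosed : IsClosed {H : C(K, ℂ) | μ (V ^ m * H) = 0} :=
    isClosed_eq (by fun_prop) continuous_const
  refine hclosed.closure_subset (Metric.mem_closure_iff.2 fun ε hε => ?_)
  obtain ⟨q, hq⟩ := exists_polynomial_near_of_continuousOn (‖sqDistMap K x‖ + 1)⁻¹ ‖V‖ g
    (hg.mono fun s hs => lt_of_lt_of_le (inv_pos.2 hM) hs.1) ε hε
  refine ⟨Polynomial.aeval V q, hpoly q, (ContinuousMap.dist_lt_iff hε).2 fun y => ?_⟩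
  rw [heval, hG, dist_comm, Complex.dist_eq, ← Complex.ofReal_sub, Complex.norm_real]
  exact hq _ (hmem y)

theorem map_expQuadMap_eq_zero (μ : C(K, ℂ) →L[ℂ] ℂ) {m : ℕ} {x : EuclideanSpace ℝ (Fin n)}
    (hx : x ∉ K) (h : ∀ k, μ (Ring.inverse (sqDistMap K x) ^ (m + k)) = 0) (t : ℝ) :
    μ (expQuadMap K ((2 * t) • x) t) = 0 := by
  let c : ℝ := Real.exp (t * ‖x‖ ^ 2)
  let g : ℝ → ℝ := fun s => (s ^ m)⁻¹ * (c * Real.exp (-t * s⁻¹))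
  have hg : ContinuousOn g (Set.Ioi 0) := by
    have h0 : ∀ s ∈ Set.Ioi (0 : ℝ), s ≠ 0 := fun s hs => ne_of_gt hs
    have h1 : ∀ s ∈ Set.Ioi (0 : ℝ), s ^ m ≠ 0 := fun s hs => pow_ne_zero _ (h0 s hs)
    fun_prop (disch := assumption)
  let G : C(K, ℂ) := sqDistMap K x ^ m * expQuadMap K ((2 * t) • x) t
  have hG : ∀ y : K, G y = g (‖x - y‖ ^ 2)⁻¹ := fun y => by
    have hexp : Real.exp (inner ℝ ((2 * t) • x) (y : EuclideanSpace ℝ (Fin n)) -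
        t * ‖(y : EuclideanSpace ℝ (Fin n))‖ ^ 2) =
        c * Real.exp (-t * ‖x - y‖ ^ 2) := by
      rw [← Real.exp_add, norm_sub_sq_real, inner_smul_left]
      congr 1
      simp only [conj_trivial]
      ring
    simp only [G, g, ContinuousMap.mul_apply, ContinuousMap.pow_apply, sqDistMap, expQuadMap,
      ContinuousMap.coe_mk, hexp, inv_pow, inv_inv]
    push_cast
    rfl
  have hmain := map_mul_comp_eq_zero μ hx h hg G hG
  rwa [← mul_assoc, ← mul_pow, Ring.inverse_mul_cancel _ (isUnit_sqDistMap hx), one_pow,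
    one_mul] at hmain

theorem map_expQuadMap_zero_eq_zero [Nontrivial (EuclideanSpace ℝ (Fin n))]
    (μ : C(K, ℂ) →L[ℂ] ℂ)
    (h : ∀ x ∉ K, ∀ t, μ (expQuadMap K ((2 * t) • x) t) = 0) (w : EuclideanSpace ℝ (Fin n)) :
    μ (expQuadMap K w 0) = 0 := by
  have hclosed : IsClosed {w : EuclideanSpace ℝ (Fin n) | μ (expQuadMap K w 0) = 0} :=
    isClosed_eq (μ.continuous.comp (continuous_expQuadMap.comp (Continuous.prodMk_left 0)))
      continuous_const
  suffices hne : ({0}ᶜ : Set (EuclideanSpace ℝ (Fin n))) ⊆ {w | μ (expQuadMap K w 0) = 0} from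
    hclosed.closure_subset_iff.2 hne (dense_compl_singleton 0 w)
  intro w hw
  have hK : IsCompact K := isCompact_iff_compactSpace.2 inferInstance
  obtain ⟨R, hR⟩ := hK.isBounded.exists_norm_le
  have hlim : Tendsto (fun t : ℝ => μ (expQuadMap K w t)) (𝓝[>] 0)
      (𝓝 (μ (expQuadMap K w 0))) :=
    ((μ.continuous.comp (continuous_expQuadMap.comp
      (Continuous.prodMk_right w))).tendsto 0).mono_left nhdsWithin_le_nhds
  have hsmall : ∀ᶠ t : ℝ in 𝓝[>] 0, 2 * t * R < ‖w‖ := by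
    have hc : Continuous fun t : ℝ => 2 * t * R := by fun_prop
    exact (hc.tendsto 0).mono_left nhdsWithin_le_nhds |>.eventually_lt_const
      (by simpa using hw)
  refine tendsto_nhds_unique hlim (tendsto_const_nhds.congr' ?_)
  filter_upwards [hsmall, self_mem_nhdsWithin] with t ht htpos
  have htpos : 0 < 2 * t := by have : 0 < t := htpos; positivity
  have hout : (2 * t)⁻¹ • w ∉ K := fun hmem => by
    have := hR _ hmem
    rw [norm_smul, Real.norm_eq_abs, abs_of_pos (inv_pos.2 htpos), inv_mul_le_iff₀ htpos] at this
    linarith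
  have := h _ hout t
  rw [smul_inv_smul₀ htpos.ne'] at this
  exact this.symm

theorem eq_zero_of_map_expQuadMap_zero (μ : C(K, ℂ) →L[ℂ] ℂ)
    (h : ∀ w, μ (expQuadMap K w 0) = 0) : μ = 0 := by
  let M : Submonoid C(K, ℂ) :=
    { carrier := Set.range fun w => expQuadMap K w 0
      one_mem' := ⟨0, by ext y; simp [expQuadMap]⟩
      mul_mem' := by
        rintro _ _ ⟨v, rfl⟩ ⟨w, rfl⟩
        refine ⟨v + w, ?_⟩
        ext y
        simp [expQuadMap, inner_add_left, Complex.exp_add] }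
  have hstar : star (M : Set C(K, ℂ)) = M := by
    have hs : ∀ f ∈ M, star f = f := by
      rintro _ ⟨w, rfl⟩
      ext y
      simp only [ContinuousMap.star_apply, expQuadMap, ContinuousMap.coe_mk]
      exact Complex.conj_ofReal _
    ext f
    refine ⟨fun hf => ?_, fun hf => ?_⟩
    · have := hs _ hf
      rw [star_star] at this
      rw [this]
      exact hf
    · change star f ∈ M
      rwa [hs f hf]
  have hspan : ((StarAlgebra.adjoin ℂ (M : Set C(K, ℂ)) : StarSubalgebra ℂ C(K, ℂ)) :
      Set C(K, ℂ)) = Submodule.span ℂ (M : Set C(K, ℂ)) := by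
    have := StarAlgebra.adjoin_eq_span (R := ℂ) (M : Set C(K, ℂ))
    rw [hstar, Set.union_self, Submonoid.closure_eq] at this
    exact congrArg SetLike.coe this
  have hsep : (StarAlgebra.adjoin ℂ (M : Set C(K, ℂ))).SeparatesPoints := by
    intro y z hyz
    let w : EuclideanSpace ℝ (Fin n) := y - z
    refine ⟨_, ⟨expQuadMap K w 0, StarAlgebra.subset_adjoin _ _ ⟨w, rfl⟩, rfl⟩, fun heq => ?_⟩
    simp only [expQuadMap, ContinuousMap.coe_mk, Complex.ofReal_inj, Real.exp_eq_exp, zero_mul,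
      sub_zero] at heq
    rw [← sub_eq_zero, ← inner_sub_right, inner_self_eq_zero, sub_eq_zero] at heq
    exact hyz (Subtype.ext heq)
  have htop := ContinuousMap.starSubalgebra_topologicalClosure_eq_top_of_separatesPoints _ hsep
  have hker : (Submodule.span ℂ (M : Set C(K, ℂ)) : Set C(K, ℂ)) ⊆ {f | μ f = 0} := by
    have : Submodule.span ℂ (M : Set C(K, ℂ)) ≤ LinearMap.ker (μ : C(K, ℂ) →ₗ[ℂ] ℂ) := by
      rw [Submodule.span_le]
      rintro _ ⟨w, rfl⟩
      exact h w
    exact fun f hf => this hf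
  have hclosed : IsClosed {f : C(K, ℂ) | μ f = 0} := isClosed_eq μ.continuous continuous_const
  ext f
  have hf : f ∈ (StarAlgebra.adjoin ℂ (M : Set C(K, ℂ))).topologicalClosure := by
    rw [htop]
    trivial
  rw [← SetLike.mem_coe, StarSubalgebra.topologicalClosure_coe, hspan] at hf
  exact hclosed.closure_subset_iff.2 hker hf

end Kernels

/-- Let `n ≥ 3`, `Ω ⊂ ℝ^n` a bounded open set, and let `μ` be a bounded measure on
`closure Ω` (an element of the dual of `C(closure Ω, ℂ)`). If
`∫ |x - y|^{4-2n} dμ(y) = 0` for every `x ∈ ℝ^n \ closure Ω`, then `μ = 0`. -/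
theorem measure_eq_zero_of_green_products_integrals_vanish
    (n : ℕ) (hn : 3 ≤ n) (Ω : Set (EuclideanSpace ℝ (Fin n)))
    (hΩo : IsOpen Ω) (hΩb : Bornology.IsBounded Ω)
    (μ : C(closure Ω, ℂ) →L[ℂ] ℂ)
    (hμ : ∀ x : EuclideanSpace ℝ (Fin n), x ∉ closure Ω →
      ∀ f : C(closure Ω, ℂ),
        (∀ y : closure Ω,
          f y = ((‖x - (y : EuclideanSpace ℝ (Fin n))‖ ^ ((4 : ℝ) - 2 * n) : ℝ) : ℂ)) →
        μ f = 0) :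
    μ = 0 := by
  have hcompact : IsCompact (closure Ω) := hΩb.isCompact_closure
  have : CompactSpace (closure Ω) := isCompact_iff_compactSpace.1 hcompact
  have : NeZero n := ⟨by omega⟩
  have : Nontrivial (EuclideanSpace ℝ (Fin n)) :=
    ⟨⟨EuclideanSpace.single 0 1, 0, fun h => by simpa using congrArg (fun v => v 0) h⟩⟩
  have hbase : ∀ x ∉ closure Ω, μ (Ring.inverse (sqDistMap (closure Ω) x) ^ (n - 2)) = 0 := by
    intro x hx
    refine hμ x hx _ fun y => ?_
    have hexp : (4 : ℝ) - 2 * n = -((2 * (n - 2) : ℕ) : ℝ) := by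
      push_cast [Nat.cast_sub (show 2 ≤ n by omega)]
      ring
    rw [ContinuousMap.pow_apply, ringInverse_sqDistMap_apply hx, ← Complex.ofReal_pow, hexp,
      Real.rpow_neg (norm_nonneg _), Real.rpow_natCast, pow_mul, inv_pow]
  have hpow := map_ringInverse_sqDistMap_pow_add isClosed_closure μ (by omega) (by omega) hbase
  exact eq_zero_of_map_expQuadMap_zero μ <| map_expQuadMap_zero_eq_zero μ fun x hx =>
    map_expQuadMap_eq_zero μ hx fun k => hpow k x hx
end

section
/- Let m ≥ 1 and let f : ℝ^{2m+1} → ℂ be a continuous function with compact support. Write points of ℝ^{2m+1} as x = (x', t) with x' ∈ ℝ^{2m} and t ∈ ℝ. If ∫_{ℝ^{2m+1}} f(x) u₁(x) u₂(x) dx = 0 for all harmonic homogeneous polynomials u₁, u₂ on ℝ^{2m+1}, then ∫_{ℝ} f(x', t) dt = 0 for every x' ∈ ℝ^{2m}. -/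
open MvPolynomial MeasureTheory

/-- A harmonic homogeneous polynomial on `ℝ^n` (with complex coefficients): a polynomial in
`n` variables that is homogeneous of some degree `d ≥ 0` and whose (algebraic) Laplacian
`Σ_j ∂²/∂x_j²` vanishes. -/
def IsHarmonicHomogeneousPolynomial {n : ℕ} (p : MvPolynomial (Fin n) ℂ) : Prop :=
  (∃ d : ℕ, p.IsHomogeneous d) ∧
    ∑ j : Fin n, MvPolynomial.pderiv j (MvPolynomial.pderiv j p) = 0

open scoped Pointwise

namespace MvPolynomial

theorem pderiv_pderiv_comm {σ R : Type*} [CommRing R] (i j : σ) (p : MvPolynomial σ R) :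
    pderiv i (pderiv j p) = pderiv j (pderiv i p) := by
  classical
  have h : ⁅pderiv (R := R) i, pderiv (R := R) j⁆ = 0 := by
    refine derivation_ext fun k => ?_
    rw [Derivation.commutator_apply, pderiv_X, pderiv_X, Pi.single_apply, Pi.single_apply]
    split_ifs <;> simp
  have := DFunLike.congr_fun h p
  rwa [Derivation.commutator_apply, Derivation.zero_apply, sub_eq_zero] at this

/-- With `ℝ^{2m+1} = ℝ^m × ℝ^m × ℝ`, the linear form `x_j + c y_j`. -/
noncomputable def pairedLinearForm (m : ℕ) (c : ℂ) (j : Fin m) :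
    MvPolynomial (Fin (2 * m + 1)) ℂ :=
  X (finProdFinEquiv ((0 : Fin 2), j)).castSucc + C c * X (finProdFinEquiv ((1 : Fin 2), j)).castSucc

theorem pairedLinearForm_isHomogeneous (m : ℕ) (c : ℂ) (j : Fin m) :
    (pairedLinearForm m c j).IsHomogeneous 1 := by
  simpa [pairedLinearForm] using (isHomogeneous_X ℂ _).add
    ((isHomogeneous_C _ c).mul (isHomogeneous_X ℂ _))

theorem exists_isHomogeneous_of_mem_closure {m : ℕ} {c : ℂ} {p : MvPolynomial (Fin (2 * m + 1)) ℂ}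
    (hp : p ∈ Submonoid.closure (Set.range (pairedLinearForm m c))) :
    ∃ d : ℕ, p.IsHomogeneous d := by
  induction hp using Submonoid.closure_induction with
  | mem _ h =>
    obtain ⟨j, rfl⟩ := h
    exact ⟨1, pairedLinearForm_isHomogeneous m c j⟩
  | one => exact ⟨0, isHomogeneous_one _ _⟩
  | mul _ _ _ _ hx hy =>
    obtain ⟨a, ha⟩ := hx
    obtain ⟨b, hb⟩ := hy
    exact ⟨a + b, ha.mul hb⟩

theorem sum_pderiv_pderiv_eq_zero_of_mem_adjoin {m : ℕ} {c : ℂ} (hc : c * c = -1)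
    {p : MvPolynomial (Fin (2 * m + 1)) ℂ}
    (hp : p ∈ Algebra.adjoin ℂ (Set.range (pairedLinearForm m c))) :
    ∑ j, pderiv j (pderiv j p) = 0 := by
  classical
  have hlast : pderiv (Fin.last (2 * m)) p = 0 := by
    refine Derivation.eqOn_adjoin (D2 := 0) ?_ hp
    rintro _ ⟨j, rfl⟩
    simp [pairedLinearForm, pderiv_X]
  have hpair (j : Fin m) : pderiv (finProdFinEquiv ((1 : Fin 2), j)).castSucc p =
      c • pderiv (finProdFinEquiv ((0 : Fin 2), j)).castSucc p := by
    refine Derivation.eqOn_adjoin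
      (D2 := c • pderiv (finProdFinEquiv ((0 : Fin 2), j)).castSucc) ?_ hp
    rintro _ ⟨k, rfl⟩
    by_cases h : k = j <;>
      simp [pairedLinearForm, pderiv_X, h, smul_eq_C_mul]
  rw [Fin.sum_univ_castSucc, hlast, map_zero, add_zero, ← finProdFinEquiv.sum_comp,
    Fintype.sum_prod_type, Fin.sum_univ_two, ← Finset.sum_add_distrib]
  refine Finset.sum_eq_zero fun j _ => ?_
  rw [hpair, Derivation.map_smul,
    pderiv_pderiv_comm (finProdFinEquiv ((1 : Fin 2), j)).castSucc, hpair,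
    Derivation.map_smul, smul_smul, hc]
  simp

theorem isHarmonicHomogeneousPolynomial_of_mem_closure {m : ℕ} {c : ℂ} (hc : c * c = -1)
    {p : MvPolynomial (Fin (2 * m + 1)) ℂ}
    (hp : p ∈ Submonoid.closure (Set.range (pairedLinearForm m c))) :
    IsHarmonicHomogeneousPolynomial p :=
  ⟨exists_isHomogeneous_of_mem_closure hp, sum_pderiv_pderiv_eq_zero_of_mem_adjoin hc
    (Algebra.adjoin_eq_span ℂ (Set.range (pairedLinearForm m c)) |>.ge
      (Submodule.subset_span hp))⟩

theorem X_castSucc_mem_adjoin_pairedLinearForm (m : ℕ) (i : Fin (2 * m)) :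
    (X i.castSucc : MvPolynomial (Fin (2 * m + 1)) ℂ) ∈ Algebra.adjoin ℂ
      (Set.range (pairedLinearForm m Complex.I) ∪ Set.range (pairedLinearForm m (-Complex.I))) := by
  obtain ⟨⟨k, j⟩, rfl⟩ := finProdFinEquiv.surjective i
  set A := Algebra.adjoin ℂ
    (Set.range (pairedLinearForm m Complex.I) ∪ Set.range (pairedLinearForm m (-Complex.I)))
  have hz : pairedLinearForm m Complex.I j ∈ A := Algebra.subset_adjoin (.inl ⟨j, rfl⟩)
  have hw : pairedLinearForm m (-Complex.I) j ∈ A := Algebra.subset_adjoin (.inr ⟨j, rfl⟩)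
  obtain rfl | rfl := Fin.exists_fin_two.mp ⟨k, rfl⟩
  · convert! A.smul_mem (A.add_mem hz hw) (1 / 2 : ℂ) using 1
    simp only [pairedLinearForm, map_neg, smul_eq_C_mul]
    have h : (C (1 / 2) * 2 : MvPolynomial (Fin (2 * m + 1)) ℂ) = 1 := by
      rw [← map_ofNat C 2, ← C_mul]
      simp
    linear_combination (-X (finProdFinEquiv ((0 : Fin 2), j)).castSucc) * h
  · convert! A.smul_mem (A.sub_mem hz hw) (1 / (2 * Complex.I) : ℂ) using 1
    simp only [pairedLinearForm, map_neg, smul_eq_C_mul]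
    have h : (C (1 / (2 * Complex.I)) * (2 * C Complex.I) :
        MvPolynomial (Fin (2 * m + 1)) ℂ) = 1 := by
      rw [← map_ofNat C 2, ← C_mul, ← C_mul, one_div_mul_cancel (by simp), C_1]
    linear_combination (-X (finProdFinEquiv ((1 : Fin 2), j)).castSucc) * h

theorem rename_castSucc_mem_span_mul_closure (m : ℕ) (q : MvPolynomial (Fin (2 * m)) ℂ) :
    rename Fin.castSucc q ∈ Submodule.span ℂ
      ((Submonoid.closure (Set.range (pairedLinearForm m Complex.I)) :
        Set (MvPolynomial (Fin (2 * m + 1)) ℂ)) *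
        (Submonoid.closure (Set.range (pairedLinearForm m (-Complex.I))) :
          Set (MvPolynomial (Fin (2 * m + 1)) ℂ))) := by
  rw [← Submodule.span_mul_span, ← Algebra.adjoin_eq_span, ← Algebra.adjoin_eq_span,
    ← Algebra.adjoin_union_coe_submodule, Subalgebra.mem_toSubmodule]
  induction q using MvPolynomial.induction_on with
  | C a =>
    rw [rename_C]
    exact Subalgebra.algebraMap_mem _ a
  | add p q hp hq => rw [map_add]; exact add_mem hp hq
  | mul_X p i hp =>
    rw [map_mul, rename_X]
    exact mul_mem hp (X_castSucc_mem_adjoin_pairedLinearForm m i)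

/-- Stone–Weierstrass for complex polynomials on a compact subset of `ℝ^n`. -/
theorem exists_norm_sub_eval_lt {ι : Type*} {K : Set (ι → ℝ)} (hK : IsCompact K)
    {g : (ι → ℝ) → ℂ} (hg : Continuous g) {ε : ℝ} (hε : 0 < ε) :
    ∃ q : MvPolynomial ι ℂ, ∀ x ∈ K, ‖g x - eval (fun i => (x i : ℂ)) q‖ < ε := by
  have : CompactSpace K := isCompact_iff_compactSpace.mp hK
  let coord (i : ι) : C(K, ℂ) := ⟨fun x => ((x : ι → ℝ) i : ℂ),
    Complex.continuous_ofReal.comp ((continuous_apply i).comp continuous_subtype_val)⟩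
  let A : StarSubalgebra ℂ C(K, ℂ) := StarAlgebra.adjoin ℂ (Set.range coord)
  have hA : A.topologicalClosure = ⊤ := by
    refine ContinuousMap.starSubalgebra_topologicalClosure_eq_top_of_separatesPoints A ?_
    intro x y hxy
    obtain ⟨i, hi⟩ := Function.ne_iff.mp (Subtype.coe_injective.ne hxy)
    refine ⟨coord i, ⟨coord i, StarAlgebra.subset_adjoin ℂ _ ⟨i, rfl⟩, rfl⟩, ?_⟩
    simpa [coord] using hi
  have hpoly (h : C(K, ℂ)) (hh : h ∈ A) :
      ∃ q : MvPolynomial ι ℂ, ∀ x : K, h x = eval (fun i => ((x : ι → ℝ) i : ℂ)) q := by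
    induction hh using StarAlgebra.adjoin_induction with
    | mem _ h =>
      obtain ⟨i, rfl⟩ := h
      exact ⟨X i, fun x => by simp [coord]⟩
    | algebraMap r => exact ⟨C r, fun x => by simp⟩
    | add _ _ _ _ hx hy =>
      obtain ⟨p, hp⟩ := hx
      obtain ⟨q, hq⟩ := hy
      exact ⟨p + q, fun x => by simp [hp, hq]⟩
    | mul _ _ _ _ hx hy =>
      obtain ⟨p, hp⟩ := hx
      obtain ⟨q, hq⟩ := hy
      exact ⟨p * q, fun x => by simp [hp, hq]⟩
    | star _ _ hx =>
      obtain ⟨p, hp⟩ := hx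
      refine ⟨map (starRingEnd ℂ) p, fun x => ?_⟩
      rw [ContinuousMap.star_apply, hp, eval_map, ← starRingEnd_apply, ← eval₂_id, hom_eval₂]
      simp
  let G : C(K, ℂ) := ⟨fun x => g x, by fun_prop⟩
  have hG : G ∈ closure (A : Set C(K, ℂ)) := by
    rw [← StarSubalgebra.topologicalClosure_coe, hA]
    trivial
  obtain ⟨h, hh, hd⟩ := Metric.mem_closure_iff.mp hG ε hε
  obtain ⟨q, hq⟩ := hpoly h hh
  refine ⟨q, fun x hx => ?_⟩
  rw [← hq ⟨x, hx⟩, ← dist_eq_norm]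
  exact (ContinuousMap.dist_apply_le_dist (f := G) (g := h) ⟨x, hx⟩).trans_lt hd

end MvPolynomial

theorem integral_mul_eval_rename_eq_zero {m : ℕ} {f : (Fin (2 * m + 1) → ℝ) → ℂ}
    (hfc : Continuous f) (hfs : HasCompactSupport f)
    (hf : ∀ p₁ p₂ : MvPolynomial (Fin (2 * m + 1)) ℂ,
      IsHarmonicHomogeneousPolynomial p₁ → IsHarmonicHomogeneousPolynomial p₂ →
      ∫ x : Fin (2 * m + 1) → ℝ, f x * eval (fun j => (x j : ℂ)) p₁ *
        eval (fun j => (x j : ℂ)) p₂ = 0) (q : MvPolynomial (Fin (2 * m)) ℂ) :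
    ∫ x : Fin (2 * m + 1) → ℝ, f x * eval (fun i => (x i.castSucc : ℂ)) q = 0 := by
  have hint (p : MvPolynomial (Fin (2 * m + 1)) ℂ) :
      Integrable fun x : Fin (2 * m + 1) → ℝ => f x * eval (fun j => (x j : ℂ)) p :=
    (hfc.mul (p.continuous_eval.comp (by fun_prop))).integrable_of_hasCompactSupport hfs.mul_right
  suffices h : ∀ p ∈ Submodule.span ℂ
      ((Submonoid.closure (Set.range (pairedLinearForm m Complex.I)) :
        Set (MvPolynomial (Fin (2 * m + 1)) ℂ)) *
        (Submonoid.closure (Set.range (pairedLinearForm m (-Complex.I))) :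
          Set (MvPolynomial (Fin (2 * m + 1)) ℂ))),
      ∫ x : Fin (2 * m + 1) → ℝ, f x * eval (fun j => (x j : ℂ)) p = 0 by
    simpa [eval_rename, Function.comp_def] using h _ (rename_castSucc_mem_span_mul_closure m q)
  intro p hp
  induction hp using Submodule.span_induction with
  | mem p h =>
    obtain ⟨p₁, h₁, p₂, h₂, rfl⟩ := h
    simpa [mul_assoc] using hf p₁ p₂
      (isHarmonicHomogeneousPolynomial_of_mem_closure (by simp) h₁)
      (isHarmonicHomogeneousPolynomial_of_mem_closure (by simp) h₂)
  | zero => simp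
  | add p q _ _ hp hq =>
    simp only [map_add, mul_add]
    rw [integral_add (hint p) (hint q), hp, hq, add_zero]
  | smul a p _ hp =>
    simp only [smul_eval, mul_left_comm _ a]
    rw [integral_const_mul, hp, mul_zero]

theorem integral_mul_comp_init_eq_zero {n : ℕ} {f : (Fin (n + 1) → ℝ) → ℂ}
    (hfc : Continuous f) (hfs : HasCompactSupport f)
    (hf : ∀ q : MvPolynomial (Fin n) ℂ,
      ∫ x : Fin (n + 1) → ℝ, f x * eval (fun i => (x i.castSucc : ℂ)) q = 0)
    {g : (Fin n → ℝ) → ℂ} (hg : Continuous g) :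
    ∫ x : Fin (n + 1) → ℝ, f x * g (fun i => x i.castSucc) = 0 := by
  have hcont : Continuous fun (x : Fin (n + 1) → ℝ) (i : Fin n) => x i.castSucc := by fun_prop
  have hfi : Integrable f := hfc.integrable_of_hasCompactSupport hfs
  have hbound (ε : ℝ) (hε : 0 < ε) :
      ‖∫ x : Fin (n + 1) → ℝ, f x * g (fun i => x i.castSucc)‖ ≤ ε * ∫ x, ‖f x‖ := by
    obtain ⟨q, hq⟩ := exists_norm_sub_eval_lt (hfs.isCompact.image hcont) hg hε
    have hgi : Integrable fun x : Fin (n + 1) → ℝ => f x * g (fun i => x i.castSucc) :=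
      (hfc.mul (hg.comp hcont)).integrable_of_hasCompactSupport hfs.mul_right
    have hqi : Integrable fun x : Fin (n + 1) → ℝ =>
        f x * eval (fun i => (x i.castSucc : ℂ)) q :=
      (hfc.mul (q.continuous_eval.comp (by fun_prop))).integrable_of_hasCompactSupport
        hfs.mul_right
    rw [← sub_zero (∫ x : Fin (n + 1) → ℝ, f x * g (fun i => x i.castSucc)), ← hf q,
      ← integral_sub hgi hqi, ← integral_const_mul]
    refine norm_integral_le_of_norm_le (hfi.norm.const_mul ε) (.of_forall fun x => ?_)
    rw [← mul_sub, norm_mul, mul_comm]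
    by_cases hx : f x = 0
    · simp [hx]
    · gcongr
      exact (hq _ ⟨x, subset_tsupport f hx, rfl⟩).le
  refine norm_eq_zero.mp (le_antisymm (le_of_forall_gt_imp_ge_of_dense fun δ hδ => ?_)
    (norm_nonneg _))
  have hI : 0 ≤ ∫ x, ‖f x‖ := integral_nonneg fun _ => norm_nonneg _
  refine (hbound (δ / ((∫ x, ‖f x‖) + 1)) (by positivity)).trans ?_
  rw [div_mul_eq_mul_div, div_le_iff₀ (by positivity)]
  nlinarith

theorem continuous_integral_snoc {n : ℕ} {f : (Fin (n + 1) → ℝ) → ℂ}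
    (hfc : Continuous f) (hfs : HasCompactSupport f) :
    Continuous fun x' : Fin n → ℝ => ∫ t : ℝ, f (Fin.snoc x' t) := by
  have hk : IsCompact ((fun x : Fin (n + 1) → ℝ => x (Fin.last n)) '' tsupport f) :=
    hfs.isCompact.image (continuous_apply _)
  rw [← continuousOn_univ]
  refine continuousOn_integral_of_compact_support hk ?_ fun x' t _ ht => ?_
  · exact (hfc.comp (Continuous.finSnoc continuous_fst continuous_snd)).continuousOn
  · by_contra h
    exact ht ⟨_, subset_tsupport f h, by simp⟩

theorem integral_mul_comp_init_eq {n : ℕ} {f : (Fin (n + 1) → ℝ) → ℂ}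
    (hfc : Continuous f) (hfs : HasCompactSupport f) {g : (Fin n → ℝ) → ℂ} (hg : Continuous g) :
    ∫ x : Fin (n + 1) → ℝ, f x * g (fun i => x i.castSucc) =
      ∫ x' : Fin n → ℝ, (∫ t : ℝ, f (Fin.snoc x' t)) * g x' := by
  have hint : Integrable fun x : Fin (n + 1) → ℝ => f x * g (fun i => x i.castSucc) :=
    (hfc.mul (hg.comp (by fun_prop))).integrable_of_hasCompactSupport hfs.mul_right
  have e := (volume_preserving_piFinSuccAbove (fun _ : Fin (n + 1) => ℝ) (Fin.last n)).symm
  have hint' := (e.integrable_comp_emb (MeasurableEquiv.measurableEmbedding _)).mpr hint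
  rw [← e.integral_comp (MeasurableEquiv.measurableEmbedding _)]
  rw [Measure.volume_eq_prod, integral_prod_symm]
  swap
  · exact hint'
  refine integral_congr_ae (.of_forall fun x' => ?_)
  simp only [← integral_mul_const]
  refine integral_congr_ae (.of_forall fun t => ?_)
  simp [MeasurableEquiv.piFinSuccAbove, Fin.insertNthEquiv, Fin.insertNth_last']

/-- Let `m ≥ 1` and let `f : ℝ^{2m+1} → ℂ` be continuous with compact support. If
`∫ f u₁ u₂ = 0` for all harmonic homogeneous polynomials `u₁, u₂` on `ℝ^{2m+1}`, then for
every `x' ∈ ℝ^{2m}` the integral of `t ↦ f(x', t)` over `ℝ` vanishes. -/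
theorem line_integrals_vanish_of_harmonic_poly_products_orthogonal
    (m : ℕ) (hm : 1 ≤ m) (f : (Fin (2 * m + 1) → ℝ) → ℂ)
    (hfc : Continuous f) (hfs : HasCompactSupport f)
    (hf : ∀ p₁ p₂ : MvPolynomial (Fin (2 * m + 1)) ℂ,
      IsHarmonicHomogeneousPolynomial p₁ → IsHarmonicHomogeneousPolynomial p₂ →
      ∫ x : Fin (2 * m + 1) → ℝ,
        f x * MvPolynomial.eval (fun j => ((x j : ℂ))) p₁ *
          MvPolynomial.eval (fun j => ((x j : ℂ))) p₂ = 0) :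
    ∀ x' : Fin (2 * m) → ℝ, ∫ t : ℝ, f (Fin.snoc x' t) = 0 := by
  have hzero : ∀ᵐ x' : Fin (2 * m) → ℝ, ∫ t : ℝ, f (Fin.snoc x' t) = 0 := by
    refine ae_eq_zero_of_integral_contDiff_smul_eq_zero
      (continuous_integral_snoc hfc hfs).locallyIntegrable fun g hg _ => ?_
    have hgc : Continuous fun x' => (g x' : ℂ) := Complex.continuous_ofReal.comp hg.continuous
    simp only [Complex.real_smul, mul_comm (Complex.ofReal _)]
    rw [← integral_mul_comp_init_eq hfc hfs hgc]
    exact integral_mul_comp_init_eq_zero hfc hfs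
      (integral_mul_eval_rename_eq_zero hfc hfs hf) hgc
  exact congrFun ((continuous_integral_snoc hfc hfs).ae_eq_iff_eq volume continuous_const |>.mp hzero)
end

section
/- Let n ≥ 2, let Ω ⊂ ℝ^n be a bounded open set, and let μ be a bounded measure on closure(Ω). If ∫_{closure(Ω)} u₁ u₂ dμ = 0 for every pair of functions u₁, u₂ : ℝ^n → ℂ that are harmonic on all of ℝ^n, then μ = 0. -/
/-- A function `u : ℝ^n → ℂ` is harmonic (on all of `ℝ^n`) if it is smooth and the sum of
its second partial derivatives in the coordinate directions vanishes everywhere. -/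
def IsEntireHarmonic {n : ℕ} (u : EuclideanSpace ℝ (Fin n) → ℂ) : Prop :=
  ContDiff ℝ (⊤ : ℕ∞) u ∧
    ∀ x : EuclideanSpace ℝ (Fin n),
      ∑ j : Fin n,
        fderiv ℝ (fun y => fderiv ℝ u y (EuclideanSpace.single j (1 : ℝ))) x
          (EuclideanSpace.single j (1 : ℝ)) = 0

open Complex in
lemma isEntireHarmonic_exp_clm {n : ℕ} (L : EuclideanSpace ℝ (Fin n) →L[ℝ] ℂ)
    (hL : ∑ j : Fin n, L (EuclideanSpace.single j (1 : ℝ)) ^ 2 = 0) :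
    IsEntireHarmonic fun x => exp (L x) := by
  have hfderiv (v y : EuclideanSpace ℝ (Fin n)) :
      fderiv ℝ (fun x => exp (L x)) y v = L v * exp (L y) := by
    rw [(L.hasFDerivAt (x := y)).cexp.fderiv]
    simp [mul_comm]
  refine ⟨L.contDiff.cexp, fun x => ?_⟩
  have hsecond (v : EuclideanSpace ℝ (Fin n)) :
      fderiv ℝ (fun y => fderiv ℝ (fun x => exp (L x)) y v) x v = L v ^ 2 * exp (L x) := by
    simp_rw [hfderiv]
    rw [((L.hasFDerivAt (x := x)).cexp.const_mul (L v)).fderiv]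
    simp only [smul_apply, smul_eq_mul]
    ring
  simp_rw [hsecond, ← Finset.sum_mul, hL, zero_mul]

open Complex in
/-- The exponential `x ↦ exp ((a + i b) · x)` is harmonic when `a + i b` is an isotropic vector. -/
lemma isEntireHarmonic_exp_inner {n : ℕ} {a b : EuclideanSpace ℝ (Fin n)}
    (hab : inner ℝ a b = 0) (hnorm : ‖a‖ = ‖b‖) :
    IsEntireHarmonic fun x => exp ((inner ℝ a x : ℝ) + I * (inner ℝ b x : ℝ)) := by
  have key := isEntireHarmonic_exp_clm
    (ofRealCLM.comp (innerSL ℝ a) + I • ofRealCLM.comp (innerSL ℝ b)) ?_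
  · simpa using key
  have h₁ : ∑ j, a j ^ 2 = ∑ j, b j ^ 2 := by
    rw [← EuclideanSpace.real_norm_sq_eq, ← EuclideanSpace.real_norm_sq_eq, hnorm]
  have h₂ : ∑ j, a j * b j = 0 := by
    rw [← hab, PiLp.inner_apply]
    exact Finset.sum_congr rfl fun j _ => by simp [mul_comm]
  have hterm (j : Fin n) :
      ((a j : ℂ) + I * (b j : ℂ)) ^ 2 =
        ((a j ^ 2 : ℝ) : ℂ) - ((b j ^ 2 : ℝ) : ℂ) + 2 * I * ((a j * b j : ℝ) : ℂ) := by
    push_cast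
    linear_combination (b j : ℂ) ^ 2 * I_sq
  simp only [add_apply, smul_apply,
    ContinuousLinearMap.comp_apply, innerSL_apply_apply, ofRealCLM_apply, smul_eq_mul,
    EuclideanSpace.inner_single_right, one_mul, conj_trivial, hterm]
  rw [Finset.sum_add_distrib, Finset.sum_sub_distrib, ← Finset.mul_sum, ← ofReal_sum,
    ← ofReal_sum, ← ofReal_sum, h₁, h₂]
  simp

lemma exists_norm_eq_inner_eq_zero_s7 {E : Type*} [NormedAddCommGroup E] [InnerProductSpace ℝ E]
    [FiniteDimensional ℝ E] (hE : 2 ≤ Module.finrank ℝ E) (b : E) :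
    ∃ a : E, inner ℝ a b = 0 ∧ ‖a‖ = ‖b‖ := by
  have hker : LinearMap.ker (innerSL ℝ b : E →ₗ[ℝ] ℝ) ≠ ⊥ :=
    LinearMap.ker_ne_bot_of_finrank_lt (by rw [Module.finrank_self]; omega)
  obtain ⟨v, hv, hv0⟩ := Submodule.exists_mem_ne_zero_of_ne_bot hker
  have hbv : inner ℝ v b = 0 := by
    rw [real_inner_comm]
    simpa using hv
  refine ⟨(‖b‖ / ‖v‖) • v, by rw [inner_smul_left, hbv, mul_zero], ?_⟩
  rw [norm_smul, norm_div, norm_norm, norm_norm, div_mul_cancel₀ _ (norm_ne_zero_iff.mpr hv0)]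

/-- The plane wave `x ↦ exp (2 i b · x)` restricted to a set `K`. -/
noncomputable def planeWave {E : Type*} [NormedAddCommGroup E] [InnerProductSpace ℝ E]
    (K : Set E) (b : E) : C(K, ℂ) where
  toFun x := Complex.exp (2 * Complex.I * (inner ℝ b (x : E) : ℝ))

section planeWave

variable {E : Type*} [NormedAddCommGroup E] [InnerProductSpace ℝ E] {K : Set E}

lemma planeWave_apply (b : E) (x : K) :
    planeWave K b x = Complex.exp (2 * Complex.I * (inner ℝ b (x : E) : ℝ)) := rfl

lemma planeWave_zero : planeWave K 0 = 1 := by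
  ext x
  simp [planeWave_apply]

lemma planeWave_add (b c : E) : planeWave K (b + c) = planeWave K b * planeWave K c := by
  ext x
  simp [planeWave_apply, inner_add_left, mul_add, Complex.exp_add]

lemma star_planeWave (b : E) : star (planeWave K b) = planeWave K (-b) := by
  ext x
  simp [planeWave_apply, ← Complex.exp_conj, Complex.conj_ofNat]

lemma exists_planeWave_ne {x y : K} (hxy : x ≠ y) : ∃ b, planeWave K b x ≠ planeWave K b y := by
  have hsub : (x : E) - y ≠ 0 := sub_ne_zero.mpr (Subtype.coe_injective.ne hxy)
  set c : E := (Real.pi / (2 * ‖(x : E) - y‖ ^ 2)) • ((x : E) - y)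
  have hc : inner ℝ c (x : E) = inner ℝ c (y : E) + Real.pi / 2 := by
    have hn : ‖(x : E) - y‖ ≠ 0 := norm_ne_zero_iff.mpr hsub
    have : inner ℝ c ((x : E) - y) = Real.pi / 2 := by
      rw [real_inner_smul_left, real_inner_self_eq_norm_sq]
      field_simp
    rw [inner_sub_right] at this
    linarith
  refine ⟨c, fun h => ?_⟩
  have hneg : planeWave K c x = -planeWave K c y := by
    rw [planeWave_apply, planeWave_apply, hc, ← mul_neg_one, ← Complex.exp_pi_mul_I,
      ← Complex.exp_add]
    congr 1
    push_cast
    ring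
  rw [h, eq_neg_iff_add_eq_zero, ← two_mul] at hneg
  exact mul_ne_zero two_ne_zero (Complex.exp_ne_zero _) hneg

variable (K) in
/-- Trigonometric polynomials are dense in the continuous functions on a compact set. -/
lemma span_range_planeWave_topologicalClosure [CompactSpace K] :
    (Submodule.span ℂ (Set.range (planeWave K))).topologicalClosure = ⊤ := by
  let M : Submonoid C(K, ℂ) :=
    { carrier := Set.range (planeWave K)
      one_mem' := ⟨0, planeWave_zero⟩
      mul_mem' := by
        rintro _ _ ⟨b, rfl⟩ ⟨c, rfl⟩
        exact ⟨b + c, planeWave_add b c⟩ }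
  have hstar : star (Set.range (planeWave K)) ⊆ Set.range (planeWave K) := by
    rintro f ⟨b, hb⟩
    exact ⟨-b, by rw [← star_planeWave, hb, star_star]⟩
  let A : StarSubalgebra ℂ C(K, ℂ) := StarAlgebra.adjoin ℂ (Set.range (planeWave K))
  have hA : Subalgebra.toSubmodule A.toSubalgebra =
      Submodule.span ℂ (Set.range (planeWave K)) := by
    rw [StarAlgebra.adjoin_toSubalgebra, Set.union_eq_self_of_subset_right hstar,
      Algebra.adjoin_eq_span]
    exact congrArg (fun N : Submonoid C(K, ℂ) => Submodule.span ℂ (N : Set C(K, ℂ)))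
      M.closure_eq
  have hsep : A.SeparatesPoints := by
    intro x y hxy
    obtain ⟨b, hb⟩ := exists_planeWave_ne hxy
    exact ⟨_, ⟨planeWave K b, StarAlgebra.subset_adjoin ℂ _ ⟨b, rfl⟩, rfl⟩, hb⟩
  rw [← hA]
  exact congrArg (Subalgebra.toSubmodule <| StarSubalgebra.toSubalgebra ·)
    (ContinuousMap.starSubalgebra_topologicalClosure_eq_top_of_separatesPoints A hsep)

end planeWave

/-- **Uniqueness for the linearized Calderón problem, Euclidean case.** Let `n ≥ 2`,
`Ω ⊂ ℝ^n` a bounded open set, and let `μ` be a bounded measure on `closure Ω` (an element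
of the dual of `C(closure Ω, ℂ)`). If `∫ u₁ u₂ dμ = 0` for every pair of functions
harmonic on all of `ℝ^n`, then `μ = 0`. -/
theorem measure_eq_zero_of_harmonic_products_integrals_vanish
    (n : ℕ) (hn : 2 ≤ n) (Ω : Set (EuclideanSpace ℝ (Fin n)))
    (hΩo : IsOpen Ω) (hΩb : Bornology.IsBounded Ω)
    (μ : C(closure Ω, ℂ) →L[ℂ] ℂ)
    (hμ : ∀ u₁ u₂ : EuclideanSpace ℝ (Fin n) → ℂ,
      IsEntireHarmonic u₁ → IsEntireHarmonic u₂ →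
      ∀ f : C(closure Ω, ℂ),
        (∀ y : closure Ω, f y = u₁ (y : EuclideanSpace ℝ (Fin n)) *
          u₂ (y : EuclideanSpace ℝ (Fin n))) →
        μ f = 0) :
    μ = 0 := by
  have : CompactSpace (closure Ω) := isCompact_iff_compactSpace.mp hΩb.isCompact_closure
  refine ContinuousLinearMap.ext_on
    (Submodule.dense_iff_topologicalClosure_eq_top.mpr
      (span_range_planeWave_topologicalClosure (closure Ω))) ?_
  rintro _ ⟨b, rfl⟩
  obtain ⟨a, hab, hnorm⟩ := exists_norm_eq_inner_eq_zero_s7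
    (by rwa [finrank_euclideanSpace_fin]) b
  refine hμ _ _ (isEntireHarmonic_exp_inner hab hnorm)
    (isEntireHarmonic_exp_inner (a := -a) (b := b) (by rw [inner_neg_left, hab, neg_zero])
      (by rw [norm_neg, hnorm])) _ fun y => ?_
  rw [planeWave_apply, ← Complex.exp_add, inner_neg_left]
  congr 1
  push_cast
  ring
end
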